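/- Suppose H assigns a real number H(n,i,j) to all integers n ≥ 1 and 1 ≤ i, j ≤ n, extended by H(n,i,j) = 0 whenever i > n or j > n, and suppose H satisfies: (base case) H(1,1,1) = 1/3; (bulk recurrence) for all n ≥ 2, 1 ≤ i ≤ n−1, 1 ≤ j ≤ n: H(n,i,j) = R(n−1,i)·H(n,n,j) + ∑_{x=1}^{j−1} H(n−1,i,x)·H(n−x, n−x, j−x) + H(n−1,i,j)·R(n−j, n−j); (boundary recurrence) for all n ≥ 2: H(n,n,j) = (1/3)·(H(n,n−1,j) + H(n−1,n−1,j)) for 1 ≤ j ≤ n−1, and H(n,n,n) = (1/3)·(H(n,n−1,n) + L(n−1,n−1)). Then H(n,i,j) = 2i(n−i+1)/(n(n+1)(n+2)) for all n ≥ 1 and 1 ≤ i, j ≤ n; in particular H(n,i,j) does not depend on j. -/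

import Mathlib

/-- Real closed form of the left-exit probability. -/
noncomputable def sgrL (m k : ℤ) : ℝ :=
  (((m - k + 1) * (m - k + 2) : ℤ) : ℝ) / (((m + 1) * (m + 2) : ℤ) : ℝ)

/-- Real closed form of the right-exit probability (with the convention `R(0,0) = 0`). -/
noncomputable def sgrR (m k : ℤ) : ℝ :=
  ((k * (k + 1) : ℤ) : ℝ) / (((m + 1) * (m + 2) : ℤ) : ℝ)

/-- Telescoping evaluation of the partial sums of `2 / ((n - x + 1) (n - x + 2))`. -/
theorem sum_Icc_two_div_mul (n k : ℤ) (hk : 0 ≤ k) (hkn : k ≤ n) :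
    ∑ x ∈ Finset.Icc (1 : ℤ) k, 2 / (((n : ℝ) - x + 1) * ((n : ℝ) - x + 2))
      = 2 / ((n : ℝ) - k + 1) - 2 / ((n : ℝ) + 1) := by
  induction k, hk using Int.leInduction with
  | base => simp
  | succ k hk ih =>
    have hins : Finset.Icc (1 : ℤ) (k + 1) = insert (k + 1) (Finset.Icc (1 : ℤ) k) := by
      ext x
      simp only [Finset.mem_Icc, Finset.mem_insert]
      omega
    have hkn' : (k : ℝ) + 1 ≤ n := by exact_mod_cast hkn
    have hk' : (0 : ℝ) ≤ k := by exact_mod_cast hk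
    rw [hins, Finset.sum_insert (by simp), ih (by omega)]
    push_cast
    have h1 : (n : ℝ) - (k + 1) + 1 ≠ 0 := by linarith
    have h2 : (n : ℝ) - (k + 1) + 2 ≠ 0 := by linarith
    have h3 : (n : ℝ) - k + 1 ≠ 0 := by linarith
    field_simp
    ring

/-- On the diagonal, `R(m, m) = m / (m + 2)`. -/
theorem sgrR_self (m : ℤ) (hm : 0 ≤ m) : sgrR m m = (m : ℝ) / ((m : ℝ) + 2) := by
  have hm' : (0 : ℝ) ≤ m := by exact_mod_cast hm
  unfold sgrR
  push_cast
  field_simp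

/-- Uniqueness of the solution of the hole recurrences: any `H` satisfying the base case,
the bulk recurrence and the boundary recurrence equals the closed form
`2i(n-i+1)/(n(n+1)(n+2))`, which in particular does not depend on `j`. -/
theorem hole_recurrence_unique_solution (H : ℤ → ℤ → ℤ → ℝ)
    (hzero : ∀ n i j : ℤ, 1 ≤ n → (n < i ∨ n < j) → H n i j = 0)
    (hbase : H 1 1 1 = 1 / 3)
    (hbulk : ∀ n i j : ℤ, 2 ≤ n → 1 ≤ i → i ≤ n - 1 → 1 ≤ j → j ≤ n →
      H n i j = sgrR (n - 1) i * H n n j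
        + (∑ x ∈ Finset.Icc (1 : ℤ) (j - 1), H (n - 1) i x * H (n - x) (n - x) (j - x))
        + H (n - 1) i j * sgrR (n - j) (n - j))
    (hbd1 : ∀ n j : ℤ, 2 ≤ n → 1 ≤ j → j ≤ n - 1 →
      H n n j = (1 / 3) * (H n (n - 1) j + H (n - 1) (n - 1) j))
    (hbd2 : ∀ n : ℤ, 2 ≤ n →
      H n n n = (1 / 3) * (H n (n - 1) n + sgrL (n - 1) (n - 1))) :
    ∀ n i j : ℤ, 1 ≤ n → 1 ≤ i → i ≤ n → 1 ≤ j → j ≤ n →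
      H n i j = ((2 * i * (n - i + 1) : ℤ) : ℝ) / ((n * (n + 1) * (n + 2) : ℤ) : ℝ) := by
  have key : ∀ N : ℤ, 1 ≤ N → ∀ n i j : ℤ, 1 ≤ n → n ≤ N → 1 ≤ i → i ≤ n → 1 ≤ j → j ≤ n →
      H n i j = ((2 * i * (n - i + 1) : ℤ) : ℝ) / ((n * (n + 1) * (n + 2) : ℤ) : ℝ) := by
    intro N hN
    induction N, hN using Int.leInduction with
    | base =>
      intro n i j hn hnN hi hin hj hjn
      obtain rfl : n = 1 := by omega
      obtain rfl : i = 1 := by omega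
      obtain rfl : j = 1 := by omega
      rw [hbase]
      norm_num
    | succ N hN ih =>
      intro n i j hn hnN hi hin hj hjn
      rcases le_or_gt n N with hle | hlt
      · exact ih n i j hn hle hi hin hj hjn
      obtain rfl : n = N + 1 := by omega
      have hN' : (1 : ℝ) ≤ N := by exact_mod_cast hN
      have hjN : (j : ℝ) ≤ N + 1 := by exact_mod_cast hjn
      have hbulk' : ∀ i : ℤ, 1 ≤ i → i ≤ N →
          H (N + 1) i j = sgrR N i * H (N + 1) (N + 1) j
            + 2 * i * (N - i + 1) / ((N : ℝ) * (N + 1) * (N + 2)) * (N / (N + 2)) := by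
        intro i hi hiN
        have hb := hbulk (N + 1) i j (by omega) hi (by omega) hj hjn
        rw [add_sub_cancel_right] at hb
        rw [hb, add_assoc]
        congr 1
        have hsum : ∑ x ∈ Finset.Icc (1 : ℤ) (j - 1),
              H N i x * H (N + 1 - x) (N + 1 - x) (j - x)
            = 2 * i * (N - i + 1) / ((N : ℝ) * (N + 1) * (N + 2))
              * (2 / ((N : ℝ) - j + 3) - 2 / ((N : ℝ) + 2)) := by
          have ht := sum_Icc_two_div_mul (N + 1) (j - 1) (by omega) (by omega)
          push_cast at ht
          rw [show (N : ℝ) - j + 3 = N + 1 - (j - 1) + 1 by ring,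
            show (N : ℝ) + 2 = N + 1 + 1 by ring, ← ht, Finset.mul_sum]
          refine Finset.sum_congr rfl fun x hx => ?_
          rw [Finset.mem_Icc] at hx
          have hxN : (x : ℝ) ≤ N := by
            have : x ≤ N := by omega
            exact_mod_cast this
          rw [ih N i x hN le_rfl hi hiN hx.1 (by omega),
            ih (N + 1 - x) (N + 1 - x) (j - x) (by omega) (by omega) (by omega) le_rfl
              (by omega) (by omega)]
          push_cast
          have h1 : (N : ℝ) + 1 - x ≠ 0 := by linarith
          have h2 : (N : ℝ) + 1 - x + 1 ≠ 0 := by linarith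
          have h3 : (N : ℝ) + 1 - x + 2 ≠ 0 := by linarith
          field_simp
          ring
        have hlast : H N i j * sgrR (N + 1 - j) (N + 1 - j)
            = 2 * i * (N - i + 1) / ((N : ℝ) * (N + 1) * (N + 2))
              * (((N : ℝ) + 1 - j) / (N - j + 3)) := by
          rw [sgrR_self _ (by omega)]
          push_cast
          rcases le_or_gt j N with hjle | hjlt
          · rw [ih N i j hN le_rfl hi hiN hj hjle]
            push_cast
            ring
          · obtain rfl : j = N + 1 := by omega
            push_cast
            simp
        rw [hsum, hlast, ← mul_add]
        congr 1
        have h1 : (N : ℝ) - j + 3 ≠ 0 := by linarith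
        field_simp
        ring
      have hdiag : H (N + 1) (N + 1) j
          = 1 / 3 * (H (N + 1) N j + 2 / (((N : ℝ) + 1) * (N + 2))) := by
        rcases le_or_gt j N with hjle | hjlt
        · rw [hbd1 (N + 1) j (by omega) hj (by omega), add_sub_cancel_right,
            ih N N j hN le_rfl hN le_rfl hj hjle]
          push_cast
          congr 2
          field_simp
          ring
        · obtain rfl : j = N + 1 := by omega
          rw [hbd2 (N + 1) (by omega), add_sub_cancel_right]
          unfold sgrL
          push_cast
          congr 2
          ring
      have hcorner : H (N + 1) (N + 1) j = 2 / (((N : ℝ) + 2) * (N + 3)) := by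
        have hb := hbulk' N hN le_rfl
        rw [sgrR_self N (by omega)] at hb
        rw [hb] at hdiag
        field_simp at hdiag ⊢
        have h0 : 2 * ((N : ℝ) + 1) ≠ 0 := by linarith
        refine mul_left_cancel₀ h0 ?_
        linear_combination hdiag
      rcases le_or_gt i N with hile | hilt
      · rw [hbulk' i hi hile, hcorner]
        unfold sgrR
        push_cast
        field_simp
        ring
      · obtain rfl : i = N + 1 := by omega
        rw [hcorner]
        push_cast
        field_simp
        ring
  exact fun n i j hn hi hin hj hjn => key n hn n i j hn le_rfl hi hin hj hjn
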